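/- Let $p \ge 5$ be a prime and $r, s, n$ positive integers with $r \ge 2$. Then $\sum_{k=0}^{n}\binom{np}{kp}^r \left(\binom{2kp}{kp}\binom{2np-2kp}{np-kp}\right)^s \equiv D_n^{(r,s)} - \frac{1}{3} p^3 B_{p-3} \sum_{k=0}^{n}\binom{n}{k}^r\left(\binom{2k}{k}\binom{2n-2k}{n-k}\right)^s \bigl(rnk(n-k) + 2sk^3 + 2s(n-k)^3\bigr) \pmod{p^4}$ (as a congruence of rational numbers, i.e. the $p$-adic valuation of the difference is at least $4$). -/

import Mathlib

open Finset

/-- The generalized Domb numbers `Dₙ^{(r,s)}`, as rational numbers. -/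
def dombRS (r s n : ℕ) : ℚ :=
  ∑ k ∈ range (n + 1),
    (n.choose k : ℚ) ^ r * (((2 * k).choose k : ℚ) * ((2 * n - 2 * k).choose (n - k))) ^ s

theorem prod_range_two_mul_add_one_reflect {A : Type*} [CommMonoid A] (g : ℕ → A) (h : ℕ) :
    ∏ i ∈ range (2 * h), g (i + 1) =
      ∏ i ∈ range h, (g (i + 1) * g (2 * h + 1 - (i + 1))) := by
  rw [two_mul, prod_range_add, prod_mul_distrib]
  congr 1
  rw [← prod_range_reflect]
  refine prod_congr rfl fun i hi => ?_
  rw [mem_range] at hi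
  congr 1
  omega

theorem sum_range_two_mul_add_one_reflect {A : Type*} [AddCommMonoid A] (g : ℕ → A) (h : ℕ) :
    ∑ i ∈ range (2 * h), g (i + 1) =
      ∑ i ∈ range h, (g (i + 1) + g (2 * h + 1 - (i + 1))) := by
  rw [two_mul, sum_range_add, sum_add_distrib]
  congr 1
  rw [← sum_range_reflect]
  refine sum_congr rfl fun i hi => ?_
  rw [mem_range] at hi
  congr 1
  omega

theorem sum_range_two_mul_even_odd {A : Type*} [AddCommMonoid A] (g : ℕ → A) (h : ℕ) :
    ∑ i ∈ range (2 * h), g (i + 1) =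
      ∑ i ∈ range h, (g (2 * (i + 1)) + g (2 * h + 1 - 2 * (i + 1))) := by
  have hodd : ∑ i ∈ range h, g (2 * h + 1 - 2 * (i + 1)) = ∑ i ∈ range h, g (2 * i + 1) := by
    rw [← sum_range_reflect]
    refine sum_congr rfl fun i hi => ?_
    rw [mem_range] at hi
    congr 1
    omega
  rw [sum_add_distrib, hodd, ← sum_add_distrib]
  clear hodd
  induction h with
  | zero => simp
  | succ h ih =>
    rw [sum_range_succ, ← ih, show 2 * (h + 1) = 2 * h + 1 + 1 by ring, sum_range_succ,
      sum_range_succ, add_assoc, add_comm (g (2 * h + 1))]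

theorem sq_dvd_sub_pow_even {A : Type*} [CommRing A] (x y : A) (g : ℕ) :
    y ^ 2 ∣ (y - x) ^ (2 * g + 2) - (x ^ (2 * g + 2) - (2 * g + 2) * y * x ^ (2 * g + 1)) := by
  obtain ⟨k, hk⟩ := Polynomial.powAddExpansion (-x) y (2 * g + 2)
  refine ⟨k, ?_⟩
  rw [show y - x = -x + y by ring, hk, show 2 * g + 2 - 1 = 2 * g + 1 by omega,
    Even.neg_pow ⟨g + 1, by ring⟩, Odd.neg_pow ⟨g, rfl⟩]
  push_cast
  ring

theorem dvd_natCast_pow_sub_one {A : Type*} [CommRing A] {p i : ℕ} (hp : p.Prime)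
    (hi : i.Coprime p) : (p : A) ∣ (i : A) ^ (p - 1) - 1 := by
  have h := Int.ModEq.pow_card_sub_one_eq_one hp (n := (i : ℤ))
    (Nat.isCoprime_iff_coprime.2 hi)
  obtain ⟨c, hc⟩ := h.symm.dvd
  refine ⟨(c : A), ?_⟩
  exact_mod_cast congrArg (Int.cast : ℤ → A) hc

theorem sq_dvd_of_half_sum_relations {A : Type*} [CommRing A]
    (p V L2 L3 M N S H T t a b c1 c2 c3 c4 c5 c6 : A)
    (h2 : 2 * a = 1) (h3 : 3 * b = 1)
    (ht : 8 * T = 1 + p * t)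
    (e1 : V + (L2 + p * L3) = p ^ 2 * c1)
    (e2 : H - (2 * L2 + 2 * p * L3) = p ^ 2 * c2)
    (e3 : 4 * H - (2 * L2 + p * L3) = p ^ 2 * c3)
    (e4 : S - (2 * M - (p - 3) * p * N) = p ^ 2 * c4)
    (e5 : S - (2 * (T * 2) * M - (p - 3) * p * T * N) = p ^ 2 * c5)
    (e6 : N - L3 = p * c6) :
    p ^ 2 ∣ 3 * V + S := by
  have hab : 12 * (a ^ 2 * b) = 1 := by linear_combination 3 * b * (2 * a + 1) * h2 + h3
  have d12 : ∃ c, 12 * M = 4 * p * t * M - 21 * p * N + p ^ 2 * c :=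
    ⟨7 * N - p * N * t + 3 * t * N + 8 * c5 - 8 * c4, by
      linear_combination 8 * e5 - 8 * e4 + (4 * M - (p - 3) * p * N) * ht⟩
  obtain ⟨c, hc⟩ := d12
  have hM : ∃ m, M = p * m := ⟨(a ^ 2 * b) * (4 * t * M - 21 * N + p * c), by
    linear_combination (a ^ 2 * b) * hc - M * hab⟩
  obtain ⟨m, hm⟩ := hM
  have hMN : ∃ d, 4 * M + 7 * p * N = p ^ 2 * d := ⟨b * (4 * t * m + c), by
    linear_combination b * hc + (b * 4 * p * t) * hm - (4 * M + 7 * p * N) * h3⟩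
  obtain ⟨d, hd⟩ := hMN
  refine ⟨a * (6 * c1 - c3 + 4 * c2 - c6 + d + 2 * c4 - 2 * N), ?_⟩
  linear_combination a * (6 * e1 - e3 + 4 * e2 - p * e6 + hd + 2 * e4) - (3 * V + S) * h2

theorem sq_dvd_three_mul_add_sum_pow {A : Type*} [CommRing A] {g : ℕ}
    (hp : (2 * (g + 2) + 1).Prime)
    (u : ℕ → A) (hu : ∀ i, 0 < i → i < 2 * (g + 2) + 1 → (i : A) * u i = 1) :
    ((2 * (g + 2) + 1 : ℕ) : A) ^ 2 ∣
      3 * ∑ i ∈ range (g + 2), u (i + 1) * u (2 * (g + 2) + 1 - (i + 1)) +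
        ∑ i ∈ range (2 * (g + 2)), ((i + 1 : ℕ) : A) ^ (2 * g + 2) := by
  have h2 := hu 2 (by omega) (by omega)
  have h3 := hu 3 (by omega) (by omega)
  push_cast at h2 h3
  set q := 2 * (g + 2) + 1 with hq
  set p : A := (q : A) with hpA
  have hpg : p = 2 * (g + 2) + 1 := by rw [hpA, hq]; push_cast; ring
  have hcast : ∀ j, j ≤ q → ((q - j : ℕ) : A) = p - j := fun j hj => by rw [Nat.cast_sub hj]
  set V := ∑ i ∈ range (g + 2), u (i + 1) * u (q - (i + 1)) with hV
  set S := ∑ i ∈ range (2 * (g + 2)), ((i + 1 : ℕ) : A) ^ (2 * g + 2) with hS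
  set L2 := ∑ i ∈ range (g + 2), u (i + 1) ^ 2 with hL2
  set L3 := ∑ i ∈ range (g + 2), u (i + 1) ^ 3 with hL3
  set M := ∑ i ∈ range (g + 2), ((i + 1 : ℕ) : A) ^ (2 * g + 2) with hM
  set N := ∑ i ∈ range (g + 2), ((i + 1 : ℕ) : A) ^ (2 * g + 1) with hN
  -- `V` in terms of half sums
  have e1 : p ^ 2 ∣ V + (L2 + p * L3) := by
    rw [hV, hL2, hL3, mul_sum, ← sum_add_distrib, ← sum_add_distrib]
    refine dvd_sum fun i hi => ?_
    rw [mem_range] at hi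
    have a := hu (i + 1) (by omega) (by omega)
    have b := hu (q - (i + 1)) (by omega) (by omega)
    rw [hcast _ (by omega)] at b
    generalize ((i + 1 : ℕ) : A) = x at a b
    generalize u (i + 1) = y at a b ⊢
    generalize u (q - (i + 1)) = z at a b ⊢
    refine ⟨z * y ^ 3, ?_⟩
    linear_combination (-y ^ 2 - p * y ^ 3) * b + (- y * z - p * y ^ 2 * z) * a
  have inv_sq : ∀ j, 0 < j → j < q → p ^ 2 ∣ u (q - j) ^ 2 - (u j ^ 2 + 2 * p * u j ^ 3) := by
    intro j hj0 hj
    have a := hu j hj0 hj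
    have b := hu (q - j) (by omega) (by omega)
    rw [hcast _ hj.le] at b
    generalize (j : A) = x at a b
    generalize u j = y at a b ⊢
    generalize u (q - j) = z at a b ⊢
    have hz : z = -y - p * y ^ 2 + p ^ 2 * (z * y ^ 2) := by
      linear_combination (-y - p * y ^ 2) * b + (- z - p * y * z) * a
    have : ∃ c, z = -y - p * y ^ 2 + p ^ 2 * c := ⟨_, hz⟩
    obtain ⟨c, hc⟩ := this
    rw [hc]
    exact ⟨y ^ 4 + p ^ 2 * c ^ 2 - 2 * c * (y + p * y ^ 2), by ring⟩
  have u_two : ∀ j, 0 < j → 2 * j < q → 2 * u (2 * j) = u j := by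
    intro j hj0 hj
    have a := hu j hj0 (by omega)
    have b := hu (2 * j) (by omega) hj
    push_cast at b
    linear_combination (u j) * b - (2 * u (2 * j)) * a
  have e2 : p ^ 2 ∣ ∑ i ∈ range (2 * (g + 2)), u (i + 1) ^ 2 - (2 * L2 + 2 * p * L3) := by
    rw [sum_range_two_mul_add_one_reflect (fun i => u i ^ 2), hL2, hL3, mul_sum, mul_sum,
      ← sum_add_distrib, ← sum_sub_distrib]
    refine dvd_sum fun i hi => ?_
    rw [mem_range] at hi
    convert inv_sq (i + 1) (by omega) (by omega) using 1
    ring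
  have e3 : p ^ 2 ∣ 4 * ∑ i ∈ range (2 * (g + 2)), u (i + 1) ^ 2 - (2 * L2 + p * L3) := by
    rw [sum_range_two_mul_even_odd (fun i => u i ^ 2), hL2, hL3, mul_sum, mul_sum, mul_sum,
      ← sum_add_distrib, ← sum_sub_distrib]
    refine dvd_sum fun i hi => ?_
    rw [mem_range] at hi
    have := inv_sq (2 * (i + 1)) (by omega) (by omega)
    rw [← u_two (i + 1) (by omega) (by omega)]
    convert this.mul_left 4 using 1
    ring
  have e4 : p ^ 2 ∣ S - (2 * M - (2 * g + 2) * p * N) := by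
    rw [hS, sum_range_two_mul_add_one_reflect (fun i => (i : A) ^ (2 * g + 2)), hM, hN, mul_sum,
      mul_sum, ← sum_sub_distrib, ← sum_sub_distrib]
    refine dvd_sum fun i hi => ?_
    rw [mem_range] at hi
    rw [hcast _ (by omega)]
    convert sq_dvd_sub_pow_even ((i + 1 : ℕ) : A) p g using 1
    ring
  have e5 : p ^ 2 ∣ S -
      (2 * 2 ^ (2 * g + 2) * M - (2 * g + 2) * p * 2 ^ (2 * g + 1) * N) := by
    rw [hS, sum_range_two_mul_even_odd (fun i => (i : A) ^ (2 * g + 2)), hM, hN, mul_sum,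
      mul_sum, ← sum_sub_distrib, ← sum_sub_distrib]
    refine dvd_sum fun i hi => ?_
    rw [mem_range] at hi
    rw [hcast _ (by omega)]
    convert sq_dvd_sub_pow_even ((2 * (i + 1) : ℕ) : A) p g using 1
    rw [Nat.cast_mul, mul_pow, mul_pow]
    push_cast
    ring
  have e6 : p ∣ N - L3 := by
    rw [hN, hL3, ← sum_sub_distrib]
    refine dvd_sum fun i hi => ?_
    rw [mem_range] at hi
    have a := hu (i + 1) (by omega) (by omega)
    have f := dvd_natCast_pow_sub_one (A := A) hp
      (Nat.coprime_of_lt_prime (Nat.succ_ne_zero i) (by omega) hp).symm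
    rw [show q - 1 = (2 * g + 1) + 3 by omega, pow_add] at f
    generalize ((i + 1 : ℕ) : A) = x at a f ⊢
    generalize u (i + 1) = y at a f ⊢
    have a3 : x ^ 3 * y ^ 3 = 1 := by rw [← mul_pow, a, one_pow]
    convert f.mul_right (y ^ 3) using 1
    linear_combination (-x ^ (2 * g + 1)) * a3
  have f2 := dvd_natCast_pow_sub_one (A := A) hp
      (Nat.coprime_of_lt_prime two_ne_zero (by omega) hp).symm
  rw [show q - 1 = (2 * g + 1) + 3 by omega, pow_add] at f2
  push_cast at f2
  obtain ⟨t, ht⟩ := f2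
  obtain ⟨c1, e1⟩ := e1
  obtain ⟨c2, e2⟩ := e2
  obtain ⟨c3, e3⟩ := e3
  obtain ⟨c4, e4⟩ := e4
  obtain ⟨c5, e5⟩ := e5
  obtain ⟨c6, e6⟩ := e6
  generalize ∑ i ∈ range (2 * (g + 2)), u (i + 1) ^ 2 = H at *
  rw [pow_succ _ (2 * g + 1)] at e5
  have ht' : 8 * 2 ^ (2 * g + 1) = 1 + p * t := by linear_combination ht
  have hg2 : (2 * (g : A) + 2) = p - 3 := by rw [hpg]; ring
  rw [hg2] at e4 e5
  exact sq_dvd_of_half_sum_relations p V L2 L3 M N S H _ t _ _ _ _ _ _ _ _ h2 h3 ht'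
    e1 e2 e3 e4 e5 e6

/-- The product of the positive integers below `n * p` that are prime to `p`. -/
def coprimeFactorial (p n : ℕ) : ℕ :=
  ∏ j ∈ range n, ∏ i ∈ range (p - 1), (j * p + (i + 1))

theorem factorial_mul_eq {p : ℕ} (hp : 0 < p) (n : ℕ) :
    (n * p).factorial = n.factorial * p ^ n * coprimeFactorial p n := by
  obtain ⟨q, rfl⟩ : ∃ q, p = q + 1 := ⟨p - 1, by omega⟩
  rw [coprimeFactorial, Nat.add_sub_cancel]
  induction n with
  | zero => simp
  | succ n ih =>
    have h := Nat.factorial_mul_ascFactorial (n * (q + 1)) (q + 1)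
    rw [Nat.ascFactorial_succ, Nat.ascFactorial_eq_prod_range] at h
    rw [Nat.add_one_mul, ← h, ih, prod_range_succ, Nat.factorial_succ, pow_succ,
      show ∏ i ∈ range q, (n * (q + 1) + 1 + i) = ∏ i ∈ range q, (n * (q + 1) + (i + 1)) from
        prod_congr rfl fun i _ => by ring]
    ring

theorem choose_mul_coprimeFactorial {p : ℕ} (hp : 0 < p) (k l : ℕ) :
    ((k + l) * p).choose (k * p) * (coprimeFactorial p k * coprimeFactorial p l) =
      (k + l).choose k * coprimeFactorial p (k + l) := by
  have h1 := Nat.add_choose_mul_factorial_mul_factorial (l * p) (k * p)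
  have h2 := Nat.add_choose_mul_factorial_mul_factorial l k
  rw [add_comm l k] at h2
  rw [← add_mul, add_comm l k, factorial_mul_eq hp, factorial_mul_eq hp, factorial_mul_eq hp,
    ← h2] at h1
  have hpos : 0 < k.factorial * l.factorial * p ^ (k + l) := by positivity
  refine Nat.eq_of_mul_eq_mul_left hpos ?_
  rw [pow_add] at *
  linarith

theorem prod_one_add_mul_of_sq_eq_zero {A ι : Type*} [CommRing A] {e : A} (he : e ^ 2 = 0)
    (s : Finset ι) (v : ι → A) : ∏ i ∈ s, (1 + e * v i) = 1 + e * ∑ i ∈ s, v i := by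
  classical
  induction s using Finset.induction_on with
  | empty => simp
  | insert a s ha ih =>
    rw [prod_insert ha, sum_insert ha, ih]
    linear_combination (v a * ∑ i ∈ s, v i) * he

theorem one_add_mul_pow_of_sq_eq_zero {A : Type*} [CommRing A] {e : A} (he : e ^ 2 = 0)
    (v : A) (r : ℕ) : (1 + e * v) ^ r = 1 + e * (r * v) := by
  simpa using prod_one_add_mul_of_sq_eq_zero he (range r) fun _ => v

theorem prod_range_add_eq {A : Type*} [CommRing A] {h : ℕ}
    (hp4 : ((2 * h + 1 : ℕ) : A) ^ 4 = 0)
    (u : ℕ → A) (hu : ∀ i, 0 < i → i < 2 * h + 1 → (i : A) * u i = 1) (j : ℕ) :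
    ∏ i ∈ range (2 * h), ((j * (2 * h + 1) + (i + 1) : ℕ) : A) =
      (2 * h).factorial * (1 + ((2 * h + 1 : ℕ) : A) ^ 2 *
        (∑ i ∈ range h, u (i + 1) * u (2 * h + 1 - (i + 1))) * ((j * (j + 1) : ℕ) : A)) := by
  set q := 2 * h + 1 with hq
  set p : A := (q : A) with hpA
  have hfac : ((2 * h).factorial : A) =
      ∏ i ∈ range h, (((i + 1 : ℕ) : A) * ((q - (i + 1) : ℕ) : A)) := by
    rw [← prod_range_add_one_eq_factorial, Nat.cast_prod]
    exact prod_range_two_mul_add_one_reflect (fun i => (i : A)) h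
  rw [prod_range_two_mul_add_one_reflect (fun i => ((j * q + i : ℕ) : A)), hfac,
    mul_right_comm (p ^ 2), ← prod_one_add_mul_of_sq_eq_zero, ← prod_mul_distrib]
  · refine prod_congr rfl fun i hi => ?_
    rw [mem_range] at hi
    have a := hu (i + 1) (by omega) (by omega)
    have b := hu (q - (i + 1)) (by omega) (by omega)
    have hs : ((q - (i + 1) : ℕ) : A) = p - ((i + 1 : ℕ) : A) := Nat.cast_sub (by omega)
    rw [Nat.cast_add (j * q), Nat.cast_add (j * q), Nat.cast_mul j q]
    rw [hs] at b ⊢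
    rw [← hpA]
    push_cast at a b ⊢
    generalize (i : A) + 1 = x at a b ⊢
    generalize u (i + 1) = y at a b ⊢
    generalize u (q - (i + 1)) = z at a b ⊢
    linear_combination (-p ^ 2 * j * (j + 1)) * b - (p ^ 2 * j * (j + 1) * (p - x) * z) * a
  · linear_combination ((j * (j + 1) : ℕ) : A) ^ 2 * hp4

theorem coprimeFactorial_eq {A : Type*} [CommRing A] {h : ℕ}
    (hp4 : ((2 * h + 1 : ℕ) : A) ^ 4 = 0)
    (u : ℕ → A) (hu : ∀ i, 0 < i → i < 2 * h + 1 → (i : A) * u i = 1) (n : ℕ) :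
    (coprimeFactorial (2 * h + 1) n : A) =
      (2 * h).factorial ^ n * (1 + ((2 * h + 1 : ℕ) : A) ^ 2 *
        (∑ i ∈ range h, u (i + 1) * u (2 * h + 1 - (i + 1))) *
          ((∑ j ∈ range n, j * (j + 1) : ℕ) : A)) := by
  rw [coprimeFactorial, Nat.cast_prod]
  simp_rw [Nat.cast_prod, Nat.add_sub_cancel]
  rw [prod_congr rfl fun j _ => prod_range_add_eq hp4 u hu j, prod_mul_distrib,
    prod_one_add_mul_of_sq_eq_zero, prod_const, card_range, Nat.cast_sum]
  rw [mul_pow, ← pow_mul, hp4, zero_mul]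

theorem three_mul_sum_range (n : ℕ) : 3 * ∑ j ∈ range n, j * (j + 1) + n = n ^ 3 := by
  induction n with
  | zero => simp
  | succ n ih =>
    rw [sum_range_succ]
    linarith [show (n + 1) ^ 3 = n ^ 3 + 3 * (n * (n + 1)) + 1 by ring]

theorem sum_range_add_eq (k l : ℕ) :
    ∑ j ∈ range (k + l), j * (j + 1) =
      ∑ j ∈ range k, j * (j + 1) + ∑ j ∈ range l, j * (j + 1) + (k + l) * k * l := by
  have h1 := three_mul_sum_range k
  have h2 := three_mul_sum_range l
  have h3 := three_mul_sum_range (k + l)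
  rw [show (k + l) ^ 3 = k ^ 3 + l ^ 3 + 3 * ((k + l) * k * l) by ring] at h3
  omega

theorem padicNorm_bernoulli'_le_one {p : ℕ} [Fact p.Prime] (n : ℕ) (hn : n + 1 < p) :
    padicNorm p (bernoulli' n) ≤ 1 := by
  induction n using Nat.strong_induction_on with
  | _ n ih =>
    rw [bernoulli'_def]
    refine padicNorm.sub.trans (max_le (by simp) (padicNorm.sum_le' (fun k hk => ?_) zero_le_one))
    rw [mem_range] at hk
    have h1 : padicNorm p ((n - k : ℚ) + 1) = 1 := by
      rw [← Nat.cast_sub hk.le, ← Nat.cast_add_one, padicNorm.nat_eq_one_iff]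
      exact Nat.not_dvd_of_pos_of_lt (Nat.succ_pos _) (by omega)
    rw [padicNorm.mul, padicNorm.div, h1, div_one]
    exact mul_le_one₀ (padicNorm.of_nat _) (padicNorm.nonneg _) (ih k hk (by omega))

theorem padicNorm_bernoulli_le_one {p : ℕ} [Fact p.Prime] (n : ℕ) (hn : n + 1 < p) :
    padicNorm p (bernoulli n) ≤ 1 := by
  rw [bernoulli, padicNorm.mul]
  refine mul_le_one₀ ?_ (padicNorm.nonneg _) (padicNorm_bernoulli'_le_one n hn)
  exact_mod_cast padicNorm.of_int (p := p) ((-1) ^ n)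

theorem padicNorm_sum_pow_sub_mul_bernoulli_le {p : ℕ} [hp : Fact p.Prime] (m : ℕ)
    (hm : m + 1 < p) :
    padicNorm p (∑ k ∈ range p, (k : ℚ) ^ m - p * bernoulli m) ≤ (p : ℚ) ^ (-2 : ℤ) := by
  have hm1 : ((m : ℚ) + 1) ≠ 0 := by positivity
  have hn1 : padicNorm p ((m : ℚ) + 1) = 1 := by
    rw [← Nat.cast_add_one, padicNorm.nat_eq_one_iff]
    exact Nat.not_dvd_of_pos_of_lt (Nat.succ_pos _) hm
  have hp0 : (0 : ℚ) < p := by exact_mod_cast hp.out.pos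
  rw [sum_range_pow, sum_range_succ, Nat.choose_succ_self_right, Nat.add_sub_cancel_left,
    show bernoulli m * ((m + 1 : ℕ) : ℚ) * (p : ℚ) ^ 1 / (m + 1) = p * bernoulli m by
      push_cast; field_simp, add_sub_cancel_right]
  refine padicNorm.sum_le' (fun i hi => ?_) (by positivity)
  rw [mem_range] at hi
  rw [padicNorm.div, hn1, div_one, show m + 1 - i = (m - 1 - i) + 2 by omega, pow_add, ← mul_assoc,
    padicNorm.mul _ ((p : ℚ) ^ 2)]
  have h2 : padicNorm p ((p : ℚ) ^ 2) ≤ (p : ℚ) ^ (-2 : ℤ) := by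
    have := (padicNorm.dvd_iff_norm_le (p := p) (n := 2) (z := ((p ^ 2 : ℕ) : ℤ))).1 dvd_rfl
    exact_mod_cast this
  refine (mul_le_of_le_one_left (padicNorm.nonneg _) ?_).trans h2
  rw [padicNorm.mul, padicNorm.mul]
  refine mul_le_one₀ (mul_le_one₀ (padicNorm_bernoulli_le_one _ (by omega)) (padicNorm.nonneg _)
    (padicNorm.of_nat _)) (padicNorm.nonneg _) ?_
  exact_mod_cast padicNorm.of_nat (p := p) (p ^ (m - 1 - i))

theorem isUnit_natCast_factorial {A : Type*} [CommRing A] {q : ℕ} (u : ℕ → A)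
    (hu : ∀ i, 0 < i → i < q + 1 → (i : A) * u i = 1) : IsUnit (q.factorial : A) := by
  rw [← prod_range_add_one_eq_factorial, Nat.cast_prod]
  refine IsUnit.prod_iff.2 fun i hi => ?_
  rw [mem_range] at hi
  exact IsUnit.of_mul_eq_one _ (hu (i + 1) (by omega) (by omega))

theorem choose_mul_prime_eq {A : Type*} [CommRing A] {g : ℕ}
    (hp : (2 * (g + 2) + 1).Prime)
    (hp4 : ((2 * (g + 2) + 1 : ℕ) : A) ^ 4 = 0)
    (u : ℕ → A) (hu : ∀ i, 0 < i → i < 2 * (g + 2) + 1 → (i : A) * u i = 1) (k l : ℕ) :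
    ((((k + l) * (2 * (g + 2) + 1)).choose (k * (2 * (g + 2) + 1)) : ℕ) : A) =
      ((k + l).choose k : A) * (1 + -(((2 * (g + 2) + 1 : ℕ) : A) ^ 2 * u 3 *
        ∑ i ∈ range (2 * (g + 2)), ((i + 1 : ℕ) : A) ^ (2 * g + 2)) *
          (((k + l) * k * l : ℕ) : A)) := by
  have h3 := hu 3 (by omega) (by omega)
  obtain ⟨c, hc⟩ := sq_dvd_three_mul_add_sum_pow hp u hu
  have h := congrArg (Nat.cast : ℕ → A) (choose_mul_coprimeFactorial hp.pos k l)
  simp only [Nat.cast_mul _ (coprimeFactorial _ _), Nat.cast_mul _ (_ * coprimeFactorial _ _),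
    coprimeFactorial_eq hp4 u hu] at h
  have hw := (isUnit_natCast_factorial u hu).pow (k + l)
  rw [sum_range_add_eq, Nat.cast_add _ ((k + l) * k * l),
    Nat.cast_add (∑ j ∈ range k, j * (j + 1))] at h
  push_cast at h3
  generalize (∑ i ∈ range (g + 2), u (i + 1) * u (2 * (g + 2) + 1 - (i + 1))) = V at *
  generalize (∑ i ∈ range (2 * (g + 2)), ((i + 1 : ℕ) : A) ^ (2 * g + 2)) = S at *
  generalize ((2 * (g + 2) + 1 : ℕ) : A) = P at *
  generalize ((∑ j ∈ range k, j * (j + 1) : ℕ) : A) = a at *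
  generalize ((∑ j ∈ range l, j * (j + 1) : ℕ) : A) = b at *
  generalize (((k + l) * k * l : ℕ) : A) = d at *
  generalize ((((k + l) * (2 * (g + 2) + 1)).choose (k * (2 * (g + 2) + 1)) : ℕ) : A) = X at *
  generalize (((k + l).choose k : ℕ) : A) = Y at *
  generalize (((2 * (g + 2)).factorial : ℕ) : A) = w at *
  have hV : -(P ^ 2 * u 3 * S) = P ^ 2 * V := by
    linear_combination (P ^ 2 * V) * h3 - P ^ 2 * u 3 * hc - u 3 * c * hp4
  rw [hV]
  have h' : X * (1 + P ^ 2 * V * (a + b)) = Y * (1 + P ^ 2 * V * (a + b + d)) := by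
    refine hw.mul_left_cancel ?_
    rw [pow_add] at *
    linear_combination h - (w ^ k * w ^ l * X * V ^ 2 * a * b) * hp4
  linear_combination (1 - P ^ 2 * V * (a + b)) * h' +
    (X * V ^ 2 * (a + b) ^ 2 - Y * V ^ 2 * (a + b) * (a + b + d)) * hp4

theorem sum_choose_mul_prime_congr (p : ℕ) (hp : p.Prime) (hp5 : 5 ≤ p) (r s n : ℕ)
    (hr : 2 ≤ r) (hs : 0 < s) (hn : 0 < n) :
    padicNorm p
        ((∑ k ∈ range (n + 1),
            ((n * p).choose (k * p) : ℚ) ^ r *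
              (((2 * k * p).choose (k * p) : ℚ) *
                ((2 * n * p - 2 * k * p).choose (n * p - k * p))) ^ s) -
          (dombRS r s n -
            (1 / 3) * (p : ℚ) ^ 3 * bernoulli (p - 3) *
              ∑ k ∈ range (n + 1),
                (n.choose k : ℚ) ^ r *
                  (((2 * k).choose k : ℚ) * ((2 * n - 2 * k).choose (n - k))) ^ s *
                    ((r : ℚ) * n * k * ((n - k : ℕ) : ℚ) + 2 * s * (k : ℚ) ^ 3 +
                      2 * s * ((n - k : ℕ) : ℚ) ^ 3))) ≤
      (p : ℚ) ^ (-(4 : ℤ)) := by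
  have : Fact p.Prime := ⟨hp⟩
  obtain ⟨g, rfl⟩ : ∃ g, p = 2 * (g + 2) + 1 := by
    obtain ⟨m, hm⟩ := hp.odd_of_ne_two (by omega)
    exact ⟨m - 2, by omega⟩
  set p := 2 * (g + 2) + 1 with hpg
  obtain ⟨Sn, hSn⟩ : ∃ m : ℕ, m = ∑ i ∈ range (2 * (g + 2)), (i + 1) ^ (2 * g + 2) := ⟨_, rfl⟩
  -- the three sums over `k`, as natural numbers
  set X : ℕ := ∑ k ∈ range (n + 1), ((n * p).choose (k * p)) ^ r *
    (((2 * k * p).choose (k * p)) * ((2 * n * p - 2 * k * p).choose (n * p - k * p))) ^ s with hX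
  set D : ℕ := ∑ k ∈ range (n + 1), (n.choose k) ^ r *
    (((2 * k).choose k) * ((2 * n - 2 * k).choose (n - k))) ^ s with hD
  set W : ℕ := ∑ k ∈ range (n + 1), (n.choose k) ^ r *
    (((2 * k).choose k) * ((2 * n - 2 * k).choose (n - k))) ^ s *
      (r * n * k * (n - k) + 2 * s * k ^ 3 + 2 * s * (n - k) ^ 3) with hW
  have key : ((p ^ 4 : ℕ) : ℤ) ∣ 3 * (X - D) + p ^ 2 * Sn * W := by
    rw [← ZMod.intCast_zmod_eq_zero_iff_dvd]
    have hp4 : (p : ZMod (p ^ 4)) ^ 4 = 0 := by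
      rw [← Nat.cast_pow, ZMod.natCast_self]
    have hu : ∀ i, 0 < i → i < p → (i : ZMod (p ^ 4)) * (i : ZMod (p ^ 4))⁻¹ = 1 :=
      fun i h0 hi => ZMod.coe_mul_inv_eq_one _
        ((Nat.coprime_of_lt_prime (p := p) (by omega) hi hp).symm.pow_right 4)
    have h3 := hu 3 (by omega) (by omega)
    have hch := choose_mul_prime_eq hp hp4 _ hu
    have hterm : (X : ZMod (p ^ 4)) =
        D + -((p : ZMod (p ^ 4)) ^ 2 * ((3 : ℕ) : ZMod (p ^ 4))⁻¹ * Sn) * W := by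
      rw [hX, hD, hW, Nat.cast_sum, Nat.cast_sum, Nat.cast_sum, mul_sum, ← sum_add_distrib]
      refine sum_congr rfl fun k hk => ?_
      obtain ⟨l, rfl⟩ := Nat.exists_eq_add_of_le (Nat.lt_succ_iff.1 (mem_range.1 hk))
      rw [← hpg] at hch
      rw [show 2 * (k + l) * p - 2 * k * p = (l + l) * p by
          rw [← Nat.sub_mul]; congr 1; omega,
        show (k + l) * p - k * p = l * p by rw [← Nat.sub_mul]; congr 1; omega,
        show 2 * (k + l) - 2 * k = l + l by omega, Nat.add_sub_cancel_left, two_mul k]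
      push_cast
      rw [hch k l, hch k k, hch l l]
      have hE : -((p : ZMod (p ^ 4)) ^ 2 * ((3 : ℕ) : ZMod (p ^ 4))⁻¹ *
        ∑ i ∈ range (2 * (g + 2)), ((i + 1 : ℕ) : ZMod (p ^ 4)) ^ (2 * g + 2)) =
          -((p : ZMod (p ^ 4)) ^ 2 * ((3 : ℕ) : ZMod (p ^ 4))⁻¹ * Sn) := by
        rw [hSn]; push_cast; rfl
      rw [hE]
      push_cast
      have he : (-((p : ZMod (p ^ 4)) ^ 2 * (3 : ZMod (p ^ 4))⁻¹ * Sn)) ^ 2 = 0 := by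
        linear_combination (3 : ZMod (p ^ 4))⁻¹ ^ 2 * Sn ^ 2 * hp4
      generalize -((p : ZMod (p ^ 4)) ^ 2 * (3 : ZMod (p ^ 4))⁻¹ * Sn) = e at he
      simp only [mul_pow, one_add_mul_pow_of_sq_eq_zero he]
      generalize ((k + l).choose k : ZMod (p ^ 4)) ^ r = a
      generalize ((k + k).choose k : ZMod (p ^ 4)) ^ s = b
      generalize ((l + l).choose l : ZMod (p ^ 4)) ^ s = c
      generalize hx : (r * ((k + l) * k * l) : ZMod (p ^ 4)) = x
      generalize hy : (s * ((k + k) * k * k) : ZMod (p ^ 4)) = y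
      generalize hz : (s * ((l + l) * l * l) : ZMod (p ^ 4)) = z
      linear_combination a * b * c * (x * y + x * z + y * z + e * x * y * z) * he -
        e * a * b * c * (hx + hy + hz)
    push_cast at hterm h3 ⊢
    rw [hterm]
    linear_combination (-(p : ZMod (p ^ 4)) ^ 2 * Sn * W) * h3
  have hS := padicNorm_sum_pow_sub_mul_bernoulli_le (p := p) (2 * g + 2) (by omega)
  have hSS : ∑ k ∈ range p, (k : ℚ) ^ (2 * g + 2) = Sn := by
    rw [hpg, sum_range_succ', hSn]
    simp
  have h3 : padicNorm p 3 = 1 := by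
    have := (padicNorm.nat_eq_one_iff (p := p) 3).2
      (Nat.not_dvd_of_pos_of_lt (by norm_num) (by omega))
    exact_mod_cast this
  rw [hSS] at hS
  have hgoal : (X : ℚ) - (D - (1 / 3) * (p : ℚ) ^ 3 * bernoulli (p - 3) * W) =
      (((3 * (X - D) + p ^ 2 * Sn * W : ℤ) : ℚ) -
        (p : ℚ) ^ 2 * W * (Sn - p * bernoulli (2 * g + 2))) / 3 := by
    rw [show p - 3 = 2 * g + 2 by omega]
    push_cast
    ring
  have hfinal : padicNorm p ((X : ℚ) - (D - (1 / 3) * (p : ℚ) ^ 3 * bernoulli (p - 3) * W)) ≤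
      (p : ℚ) ^ (-(4 : ℤ)) := by
    rw [hgoal, padicNorm.div, h3, div_one]
    refine padicNorm.sub.trans (max_le (padicNorm.dvd_iff_norm_le.1 key) ?_)
    have hp2 : padicNorm p ((p : ℚ) ^ 2 * W) ≤ (p : ℚ) ^ (-2 : ℤ) := by
      have := (padicNorm.dvd_iff_norm_le (p := p) (n := 2) (z := ((p ^ 2 * W : ℕ) : ℤ))).1
        (by push_cast; exact dvd_mul_right _ _)
      exact_mod_cast this
    rw [padicNorm.mul, show (-(4 : ℤ)) = -2 + -2 by norm_num,
      zpow_add₀ (by exact_mod_cast hp.ne_zero)]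
    exact mul_le_mul hp2 hS (padicNorm.nonneg _) (by positivity)
  convert hfinal using 3
  · rw [hX]; push_cast; rfl
  · rw [hD, dombRS, hW]; push_cast; rfl
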